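/- arXiv:1601.06037 — 6 statements merged into one kernel-verified Lean document; each statement's English description precedes it below -/
import Mathlib

section
/- Let V be a finite-dimensional vector space over the finite field F_q with dim V = d_V, let V₂ ⊆ V₁ ⊆ V be subspaces with dim V₁ = d_{V₁} and dim V₂ = d_{V₂}, let d_U be an integer with d_{V₂} ≤ d_U, and let U' be a fixed subspace of the quotient space V/V₁ with dim U' = d_U − d_{V₂}. Then the number of d_U-dimensional subspaces U ⊆ V such that U ∩ V₁ = V₂ and the image of U under the quotient map V → V/V₁ equals U' is exactly q^{(d_U − d_{V₂})(d_{V₁} − d_{V₂})}. -/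
/-- Given a linear map `r : V → E`, the subspace attached to
`f : U' → E` consists of those `v` with image in `U'` and `r v = f v̄`. -/
def Submodule.graphLift {F V E : Type*} [Field F] [AddCommGroup V] [Module F V]
    [AddCommGroup E] [Module F E] {V₁ : Submodule F V} (r : V →ₗ[F] E)
    (U' : Submodule F (V ⧸ V₁)) (f : U' →ₗ[F] E) : Submodule F V where
  carrier := {v | ∃ h : V₁.mkQ v ∈ U', r v = f ⟨V₁.mkQ v, h⟩}
  zero_mem' := ⟨by simp, by
    rw [map_zero]; exact (map_zero f).symm.trans (congrArg f (Subtype.ext (by simp)))⟩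
  add_mem' := by
    rintro a b ⟨ha, ha'⟩ ⟨hb, hb'⟩
    refine ⟨by rw [map_add]; exact add_mem ha hb, ?_⟩
    rw [map_add, ha', hb', ← map_add]
    exact congrArg f (Subtype.ext (by simp))
  smul_mem' := by
    rintro c a ⟨ha, ha'⟩
    refine ⟨by rw [map_smul]; exact U'.smul_mem c ha, ?_⟩
    rw [map_smul, ha', ← map_smul]
    exact congrArg f (Subtype.ext (by simp))

section

variable {F V E : Type*} [Field F] [AddCommGroup V] [Module F V] [AddCommGroup E] [Module F E]
  {V₁ V₂ : Submodule F V} {r : V →ₗ[F] E} {U' : Submodule F (V ⧸ V₁)}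

theorem Submodule.mem_graphLift {f : U' →ₗ[F] E} {v : V} :
    v ∈ graphLift r U' f ↔ ∃ h : V₁.mkQ v ∈ U', r v = f ⟨V₁.mkQ v, h⟩ := Iff.rfl

theorem Submodule.exists_mkQ_eq_and_apply_eq (hr : ∀ e, ∃ v ∈ V₁, r v = e) (x : V ⧸ V₁) (e : E) :
    ∃ v, V₁.mkQ v = x ∧ r v = e := by
  obtain ⟨v, rfl⟩ := V₁.mkQ_surjective x
  obtain ⟨w, hw, hwe⟩ := hr (e - r v)
  refine ⟨v + w, ?_, by rw [map_add, hwe]; abel⟩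
  have hw0 : V₁.mkQ w = 0 := by simpa using hw
  rw [map_add, hw0, add_zero]

theorem Submodule.graphLift_inf (hker : LinearMap.ker r ⊓ V₁ = V₂) (f : U' →ₗ[F] E) :
    graphLift r U' f ⊓ V₁ = V₂ := by
  rw [← hker]
  ext v
  simp only [mem_inf, mem_graphLift, LinearMap.mem_ker]
  refine and_congr_left fun hv => ?_
  have h0 : V₁.mkQ v = 0 := by simpa using hv
  have hf : ∀ h : V₁.mkQ v ∈ U', f ⟨V₁.mkQ v, h⟩ = 0 := fun h =>
    (congrArg f (Subtype.ext h0)).trans (map_zero f)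
  exact ⟨fun ⟨h, hrv⟩ => hrv.trans (hf h),
    fun hrv => ⟨h0 ▸ U'.zero_mem, hrv.trans (hf _).symm⟩⟩

theorem Submodule.map_mkQ_graphLift (hr : ∀ e, ∃ v ∈ V₁, r v = e) (f : U' →ₗ[F] E) :
    (graphLift r U' f).map V₁.mkQ = U' := by
  ext x
  constructor
  · rintro ⟨v, ⟨h, -⟩, rfl⟩
    exact h
  · intro hx
    obtain ⟨v, rfl, hv⟩ := exists_mkQ_eq_and_apply_eq hr x (f ⟨x, hx⟩)
    exact ⟨v, ⟨hx, hv⟩, rfl⟩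

theorem Submodule.graphLift_injective (hr : ∀ e, ∃ v ∈ V₁, r v = e) :
    Function.Injective (graphLift r U') := by
  intro f g hfg
  ext ⟨x, hx⟩
  obtain ⟨v, rfl, hv⟩ := exists_mkQ_eq_and_apply_eq hr x (f ⟨x, hx⟩)
  have hmem : v ∈ graphLift r U' f := ⟨hx, hv⟩
  rw [hfg] at hmem
  exact hv.symm.trans hmem.2

theorem Submodule.exists_graphLift_eq (hker : LinearMap.ker r ⊓ V₁ = V₂) {U : Submodule F V}
    (hU : U ⊓ V₁ = V₂) (hmap : U.map V₁.mkQ = U') : ∃ f, graphLift r U' f = U := by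
  subst hmap
  obtain ⟨t, ht⟩ := (V₁.mkQ.submoduleMap U).exists_rightInverse_of_surjective
    (LinearMap.range_eq_top.2 (V₁.mkQ.submoduleMap_surjective U))
  have hsub : ∀ v (h : V₁.mkQ v ∈ U.map V₁.mkQ), v - t ⟨V₁.mkQ v, h⟩ ∈ V₁ := by
    intro v h
    have hv := congrArg Subtype.val (LinearMap.congr_fun ht ⟨V₁.mkQ v, h⟩)
    exact (Quotient.eq V₁).1 hv.symm
  refine ⟨r ∘ₗ U.subtype ∘ₗ t, ?_⟩
  ext v
  constructor
  · rintro ⟨h, hv⟩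
    have hmem : v - t ⟨V₁.mkQ v, h⟩ ∈ U ⊓ V₁ := by
      rw [hU, ← hker]
      exact ⟨by rw [SetLike.mem_coe, LinearMap.mem_ker, map_sub, sub_eq_zero]; exact hv, hsub v h⟩
    simpa using add_mem hmem.1 (t ⟨V₁.mkQ v, h⟩).2
  · intro hv
    have h := mem_map_of_mem (f := V₁.mkQ) hv
    have hmem : v - t ⟨V₁.mkQ v, h⟩ ∈ LinearMap.ker r ⊓ V₁ := by
      rw [hker, ← hU]
      exact ⟨sub_mem hv (t _).2, hsub v h⟩
    refine ⟨h, ?_⟩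
    have h0 := hmem.1
    rwa [SetLike.mem_coe, LinearMap.mem_ker, map_sub, sub_eq_zero] at h0

/-- Subspaces with prescribed intersection with `V₁` and prescribed image `U'` modulo `V₁` are as
numerous as linear maps from `U'` to `V₁ ⧸ V₂`. -/
theorem Submodule.card_inf_eq_and_map_mkQ_eq (hV : V₂ ≤ V₁) (U' : Submodule F (V ⧸ V₁)) :
    Nat.card {U : Submodule F V // U ⊓ V₁ = V₂ ∧ U.map V₁.mkQ = U'} =
      Nat.card (U' →ₗ[F] V₁ ⧸ V₂.submoduleOf V₁) := by
  obtain ⟨r, hr⟩ := (V₂.submoduleOf V₁).mkQ.exists_extend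
  have hr' (v : V₁) : r v = (V₂.submoduleOf V₁).mkQ v := LinearMap.congr_fun hr v
  have hsurj : ∀ e, ∃ v ∈ V₁, r v = e := by
    intro e
    obtain ⟨v, rfl⟩ := mkQ_surjective _ e
    exact ⟨v, v.2, hr' v⟩
  have hker : LinearMap.ker r ⊓ V₁ = V₂ := by
    ext v
    have key (hv : v ∈ V₁) : r v = 0 ↔ v ∈ V₂ := by
      rw [hr' ⟨v, hv⟩, mkQ_apply, Quotient.mk_eq_zero]
      rfl
    exact ⟨fun h => (key h.2).1 h.1, fun h => ⟨(key (hV h)).2 h, hV h⟩⟩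
  symm
  refine Nat.card_eq_of_bijective
    (fun f => ⟨graphLift r U' f, graphLift_inf hker f, map_mkQ_graphLift hsurj f⟩) ⟨?_, ?_⟩
  · exact fun f g hfg => graphLift_injective hsurj (congrArg Subtype.val hfg)
  · rintro ⟨U, hU, hmap⟩
    obtain ⟨f, hf⟩ := exists_graphLift_eq hker hU hmap
    exact ⟨f, Subtype.ext hf⟩

theorem Submodule.finrank_map_mkQ_add_finrank_inf [FiniteDimensional F V] (U V₁ : Submodule F V) :
    Module.finrank F (U.map V₁.mkQ) + Module.finrank F (U ⊓ V₁ : Submodule F V) =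
      Module.finrank F U := by
  have h := (V₁.mkQ.domRestrict U).finrank_range_add_finrank_ker
  rwa [LinearMap.range_domRestrict, LinearMap.ker_domRestrict, ker_mkQ,
    ← finrank_map_subtype_eq, map_comap_subtype] at h

end


/-- Counting subspaces `U` of fixed dimension with prescribed intersection
with `V₁` and prescribed image in the quotient `V ⧸ V₁`. -/
theorem count_subspaces_fixed_intersection_and_image
    (q : ℕ) (F : Type*) [Field F] [Fintype F] (hq : Fintype.card F = q)
    (V : Type*) [AddCommGroup V] [Module F V] [FiniteDimensional F V]
    (dV dV₁ dV₂ dU : ℕ) (hdV : Module.finrank F V = dV)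
    (V₁ V₂ : Submodule F V) (hV₂V₁ : V₂ ≤ V₁)
    (hdV₁ : Module.finrank F V₁ = dV₁) (hdV₂ : Module.finrank F V₂ = dV₂)
    (hle : dV₂ ≤ dU)
    (U' : Submodule F (V ⧸ V₁)) (hU' : Module.finrank F U' = dU - dV₂) :
    Nat.card {U : Submodule F V //
        Module.finrank F U = dU ∧ U ⊓ V₁ = V₂ ∧ U.map V₁.mkQ = U'} =
      q ^ ((dU - dV₂) * (dV₁ - dV₂)) := by
  have hdim (U : Submodule F V) :
      (Module.finrank F U = dU ∧ U ⊓ V₁ = V₂ ∧ U.map V₁.mkQ = U') ↔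
        (U ⊓ V₁ = V₂ ∧ U.map V₁.mkQ = U') := by
    refine and_iff_right_of_imp ?_
    rintro ⟨hU, hmap⟩
    rw [← U.finrank_map_mkQ_add_finrank_inf V₁, hU, hmap, hU', hdV₂]
    omega
  have hquot : Module.finrank F (V₁ ⧸ V₂.submoduleOf V₁) = dV₁ - dV₂ := by
    rw [Submodule.finrank_quotient, hdV₁,
      (Submodule.submoduleOfEquivOfLe hV₂V₁).finrank_eq, hdV₂]
  rw [Nat.card_congr (Equiv.subtypeEquivRight hdim), Submodule.card_inf_eq_and_map_mkQ_eq hV₂V₁,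
    Module.natCard_eq_pow_finrank (K := F), Module.finrank_linearMap, hU', hquot,
    Nat.card_eq_fintype_card, hq]
end

section
/- Let V be a finite-dimensional vector space over F_q with dim V = d_V, let V₁ ⊆ V be a subspace with dim V₁ = d_{V₁}, let d_U and d_{U'} be integers with d_{U'} ≤ d_U, and let U' be a fixed d_{U'}-dimensional subspace of the quotient space V/V₁. Then the number of d_U-dimensional subspaces U ⊆ V whose image under the quotient map V → V/V₁ equals U' is q^{d_{U'}(d_{V₁} − (d_U − d_{U'}))} · [d_{V₁} choose d_U − d_{U'}]_q. -/
/-- The Gaussian binomial coefficient `[a choose b]_q`: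
`∏_{i=0}^{b-1} (q^a - q^i)/(q^b - q^i)` for `b ≤ a`, and `0` for `b > a`
(note that for `b > a` the numerator below contains the factor `q^a - q^a = 0`). -/
noncomputable def gaussBinom (q a b : ℕ) : ℕ :=
  (∏ i ∈ Finset.range b, (q ^ a - q ^ i)) / (∏ i ∈ Finset.range b, (q ^ b - q ^ i))

/-- Grouping linearly independent families by the subspace they span. -/
theorem card_submodule_mul_card_linearIndependent (F V : Type*) [Field F] [Fintype F]
    [AddCommGroup V] [Module F V] [FiniteDimensional F V] (k : ℕ) :
    Nat.card {W : Submodule F V // Module.finrank F W = k} *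
        ∏ i ∈ Finset.range k, (Fintype.card F ^ k - Fintype.card F ^ i) =
      Nat.card {s : Fin k → V // LinearIndependent F s} := by
  have : Finite V := Module.finite_of_finite F
  have hext (p p' : Σ W : {W : Submodule F V // Module.finrank F W = k},
      {s : Fin k → W.1 // LinearIndependent F s}) (h : p.1.1 = p'.1.1)
      (h' : ∀ i, (p.2.1 i : V) = p'.2.1 i) : p = p' := by
    obtain ⟨⟨W, hW⟩, ⟨s, hs⟩⟩ := p
    obtain ⟨⟨W', hW'⟩, ⟨s', hs'⟩⟩ := p'
    obtain rfl : W = W' := h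
    obtain rfl : s = s' := funext fun i => Subtype.ext (h' i)
    rfl
  let e : {s : Fin k → V // LinearIndependent F s} ≃
      Σ W : {W : Submodule F V // Module.finrank F W = k},
        {s : Fin k → W.1 // LinearIndependent F s} :=
    { toFun := fun s => ⟨⟨Submodule.span F (Set.range s.1), by
          simpa using finrank_span_eq_card s.2⟩,
          ⟨fun i => ⟨s.1 i, Submodule.subset_span ⟨i, rfl⟩⟩, linearIndependent_span s.2⟩⟩
      invFun := fun p => ⟨fun i => (p.2.1 i : V),
        p.2.2.map' p.1.1.subtype (Submodule.ker_subtype _)⟩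
      left_inv := fun s => rfl
      right_inv := by
        rintro ⟨⟨W, hW⟩, ⟨s, hs⟩⟩
        have hspan : Submodule.span F (Set.range fun i => (s i : V)) = W := by
          apply Submodule.eq_of_le_of_finrank_eq
          · rw [Submodule.span_le]
            rintro _ ⟨i, rfl⟩
            exact (s i).2
          · have h := finrank_span_eq_card (hs.map' W.subtype (Submodule.ker_subtype _))
            rw [hW]
            exact h.trans (Fintype.card_fin k)
        exact hext _ _ hspan fun _ => rfl }
  have : Fintype {W : Submodule F V // Module.finrank F W = k} := Fintype.ofFinite _
  rw [Nat.card_congr e, Nat.card_sigma]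
  have hfib (W : {W : Submodule F V // Module.finrank F W = k}) :
      Nat.card {s : Fin k → W.1 // LinearIndependent F s} =
        ∏ i ∈ Finset.range k, (Fintype.card F ^ k - Fintype.card F ^ i) := by
    rw [card_linearIndependent W.2.ge, W.2, Finset.prod_range]
  simp only [hfib, Finset.sum_const, Finset.card_univ, smul_eq_mul, Nat.card_eq_fintype_card]

theorem gaussBinom_eq_zero_of_lt (q : ℕ) {a b : ℕ} (h : a < b) : gaussBinom q a b = 0 := by
  have h0 : ∏ i ∈ Finset.range b, (q ^ a - q ^ i) = 0 :=
    Finset.prod_eq_zero (Finset.mem_range.mpr h) (Nat.sub_self (q ^ a))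
  rw [gaussBinom, h0, Nat.zero_div]

/-- The Gaussian binomial coefficient counts subspaces of a given dimension. -/
theorem card_submodule_finrank_eq (F V : Type*) [Field F] [Fintype F]
    [AddCommGroup V] [Module F V] [FiniteDimensional F V] (k : ℕ) :
    Nat.card {W : Submodule F V // Module.finrank F W = k} =
      gaussBinom (Fintype.card F) (Module.finrank F V) k := by
  have : Finite V := Module.finite_of_finite F
  rcases le_or_gt k (Module.finrank F V) with hk | hk
  · have hpos : 0 < ∏ i ∈ Finset.range k, (Fintype.card F ^ k - Fintype.card F ^ i) :=
      Finset.prod_pos fun i hi => Nat.sub_pos_of_lt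
        (Nat.pow_lt_pow_right Fintype.one_lt_card (Finset.mem_range.mp hi))
    have hcount := card_submodule_mul_card_linearIndependent F V k
    rw [card_linearIndependent hk] at hcount
    rw [gaussBinom, Finset.prod_range (n := k) fun i =>
      Fintype.card F ^ Module.finrank F V - Fintype.card F ^ i, ← hcount,
      Nat.mul_div_cancel _ hpos]
  · have : IsEmpty {W : Submodule F V // Module.finrank F W = k} :=
      ⟨fun W => hk.not_ge (W.2 ▸ Submodule.finrank_le W.1)⟩
    rw [gaussBinom_eq_zero_of_lt _ hk, Nat.card_of_isEmpty]

theorem card_linearMap (F A B : Type*) [Field F] [Fintype F] [AddCommGroup A] [Module F A]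
    [FiniteDimensional F A] [AddCommGroup B] [Module F B] [FiniteDimensional F B] :
    Nat.card (A →ₗ[F] B) =
      Fintype.card F ^ (Module.finrank F A * Module.finrank F B) := by
  rw [Module.natCard_eq_pow_finrank (K := F), Module.finrank_linearMap, Nat.card_eq_fintype_card]

section Quotient

variable {F V : Type*} [Field F] [AddCommGroup V] [Module F V]

theorem finrank_comap_subtype_add_finrank_map_mkQ [FiniteDimensional F V]
    (V₁ U : Submodule F V) :
    Module.finrank F (U.comap V₁.subtype) + Module.finrank F (U.map V₁.mkQ) =
      Module.finrank F U := by
  have h := LinearMap.finrank_range_add_finrank_ker (V₁.mkQ.domRestrict U)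
  rw [LinearMap.range_domRestrict, LinearMap.ker_domRestrict, Submodule.ker_mkQ] at h
  rw [← h, add_comm, ← Submodule.finrank_map_subtype_eq V₁, ← Submodule.finrank_map_subtype_eq U,
    Submodule.map_comap_subtype, Submodule.map_comap_subtype, inf_comm]

/-- Linear lifts along `V → V ⧸ V₁` of the inclusion of `U'`, with values in `U`. -/
abbrev LiftInto (V₁ : Submodule F V) (U' : Submodule F (V ⧸ V₁)) (U : Submodule F V) :=
  {t : U' →ₗ[F] V // V₁.mkQ ∘ₗ t = U'.subtype ∧ ∀ x, t x ∈ U}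

theorem LiftInto.nonempty {V₁ : Submodule F V} {U' : Submodule F (V ⧸ V₁)} {U : Submodule F V}
    (h : U.map V₁.mkQ = U') : Nonempty (LiftInto V₁ U' U) := by
  subst h
  obtain ⟨g, hg⟩ := LinearMap.exists_rightInverse_of_surjective
    (V₁.mkQ.submoduleMap U) (LinearMap.range_eq_top.mpr (V₁.mkQ.submoduleMap_surjective U))
  refine ⟨⟨U.subtype ∘ₗ g, ?_, fun x => (g x).2⟩⟩
  ext x
  exact congrArg Subtype.val (LinearMap.congr_fun hg x)

/-- The lifts with values in `U` form a torsor under the linear maps `U' → U ∩ V₁`. -/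
def LiftInto.equivLinearMap {V₁ : Submodule F V} {U' : Submodule F (V ⧸ V₁)} {U : Submodule F V}
    (t₀ : LiftInto V₁ U' U) : LiftInto V₁ U' U ≃ (U' →ₗ[F] U.comap V₁.subtype) where
  toFun t := LinearMap.codRestrict _ (LinearMap.codRestrict V₁ (t.1 - t₀.1) fun x => by
      have h := LinearMap.congr_fun (t.2.1.trans t₀.2.1.symm) x
      exact (Submodule.Quotient.eq V₁).mp h)
    fun x => U.sub_mem (t.2.2 x) (t₀.2.2 x)
  invFun f := ⟨t₀.1 + V₁.subtype ∘ₗ (U.comap V₁.subtype).subtype ∘ₗ f, by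
      rw [LinearMap.comp_add, t₀.2.1, ← LinearMap.comp_assoc]
      ext x
      simp, fun x => U.add_mem (t₀.2.2 x) (f x).2⟩
  left_inv t := by
    ext x
    exact add_sub_cancel (t₀.1 x) (t.1 x)
  right_inv f := by
    ext x
    simp

/-- Given a lift `t`, subspaces `U` containing its range with image `U'` correspond to
subspaces of `V₁`. -/
def LiftInto.equivSubmodule {V₁ : Submodule F V} {U' : Submodule F (V ⧸ V₁)}
    (t : U' →ₗ[F] V) (ht : V₁.mkQ ∘ₗ t = U'.subtype) :
    {U : Submodule F V // U.map V₁.mkQ = U' ∧ ∀ x, t x ∈ U} ≃ Submodule F V₁ where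
  toFun U := U.1.comap V₁.subtype
  invFun W := ⟨W.map V₁.subtype ⊔ LinearMap.range t, by
      rw [Submodule.map_sup, ← LinearMap.range_comp, ht, Submodule.range_subtype,
        ← Submodule.map_comp]
      have h0 : V₁.mkQ ∘ₗ V₁.subtype = 0 := by
        ext x
        simp
      rw [h0, Submodule.map_zero, bot_sup_eq],
    fun x => Submodule.mem_sup_right ⟨x, rfl⟩⟩
  left_inv := by
    rintro ⟨U, hU, htU⟩
    apply Subtype.ext
    apply le_antisymm
    · refine sup_le (Submodule.map_comap_le _ _) ?_
      rintro _ ⟨x, rfl⟩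
      exact htU x
    · intro u hu
      have hu' : V₁.mkQ u ∈ U' := hU ▸ Submodule.mem_map_of_mem hu
      have h1 : V₁.mkQ (t ⟨V₁.mkQ u, hu'⟩) = V₁.mkQ u := LinearMap.congr_fun ht ⟨_, hu'⟩
      have h2 : u - t ⟨V₁.mkQ u, hu'⟩ ∈ V₁ := (Submodule.Quotient.eq V₁).mp h1.symm
      rw [← sub_add_cancel u (t ⟨V₁.mkQ u, hu'⟩)]
      exact Submodule.add_mem_sup ⟨⟨_, h2⟩, U.sub_mem hu (htU _), rfl⟩ ⟨_, rfl⟩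
  right_inv W := by
    ext v
    constructor
    · intro hv
      obtain ⟨_, ⟨w, hw, rfl⟩, _, ⟨x, rfl⟩, h⟩ := Submodule.mem_sup.mp hv
      have hx : x = 0 := by
        have h1 := congrArg V₁.mkQ h
        have h2 : V₁.mkQ (t x) = x := LinearMap.congr_fun ht x
        rw [map_add, h2] at h1
        apply Subtype.ext
        simpa [(Submodule.Quotient.mk_eq_zero V₁).mpr w.2,
            (Submodule.Quotient.mk_eq_zero V₁).mpr v.2] using h1
      subst hx
      have : w = v := Subtype.ext (by simpa using h)
      exact this ▸ hw
    · intro hv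
      exact Submodule.mem_sup_left ⟨v, hv, rfl⟩

end Quotient

/-- the number of `d_U`-dimensional subspaces `U ⊆ V` whose image in the
quotient `V ⧸ V₁` is a fixed `d_{U'}`-dimensional subspace `U'`. -/
theorem count_subspaces_fixed_image
    (q : ℕ) (F : Type*) [Field F] [Fintype F] (hq : Fintype.card F = q)
    (V : Type*) [AddCommGroup V] [Module F V] [FiniteDimensional F V]
    (dV dV₁ dU dU' : ℕ) (hdV : Module.finrank F V = dV)
    (V₁ : Submodule F V) (hdV₁ : Module.finrank F V₁ = dV₁)
    (hle : dU' ≤ dU)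
    (U' : Submodule F (V ⧸ V₁)) (hU' : Module.finrank F U' = dU') :
    Nat.card {U : Submodule F V //
        Module.finrank F U = dU ∧ U.map V₁.mkQ = U'} =
      q ^ (dU' * (dV₁ - (dU - dU'))) * gaussBinom q dV₁ (dU - dU') := by
  subst hq hdV₁ hU'
  have : Finite V := Module.finite_of_finite F
  have : Finite (U' →ₗ[F] V) := Module.finite_of_finite F
  let S := {U : Submodule F V // Module.finrank F U = dU ∧ U.map V₁.mkQ = U'}
  let T := {t : U' →ₗ[F] V // V₁.mkQ ∘ₗ t = U'.subtype}
  let k := dU - Module.finrank F U'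
  have hT : Nat.card T =
      Fintype.card F ^ (Module.finrank F U' * Module.finrank F V₁) := by
    obtain ⟨t₀⟩ := LiftInto.nonempty
      (Submodule.map_comap_eq_of_surjective V₁.mkQ_surjective U')
    let t₁ : LiftInto V₁ U' ⊤ := ⟨t₀.1, t₀.2.1, fun _ => trivial⟩
    let e : T ≃ LiftInto V₁ U' ⊤ := Equiv.subtypeEquivRight fun t => by simp
    rw [Nat.card_congr (e.trans t₁.equivLinearMap), card_linearMap, Submodule.comap_top,
      finrank_top]
  have hfinrank (U : Submodule F V) (hU : U.map V₁.mkQ = U') :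
      Module.finrank F U = dU ↔ Module.finrank F (U.comap V₁.subtype) = k := by
    have h := finrank_comap_subtype_add_finrank_map_mkQ V₁ U
    rw [hU] at h
    omega
  have hS (U : S) : Nat.card {t : T // ∀ x, t.1 x ∈ U.1} =
      Fintype.card F ^ (Module.finrank F U' * k) := by
    obtain ⟨t₀⟩ := LiftInto.nonempty U.2.2
    rw [Nat.card_congr ((Equiv.subtypeSubtypeEquivSubtypeInter _
        (fun t : U' →ₗ[F] V => ∀ x, t x ∈ U.1)).trans t₀.equivLinearMap),
      card_linearMap, (hfinrank _ U.2.2).mp U.2.1]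
  have hfib (t : T) : Nat.card {U : S // ∀ x, t.1 x ∈ U.1} =
      gaussBinom (Fintype.card F) (Module.finrank F V₁) k := by
    rw [← card_submodule_finrank_eq]
    let e₁ : {U : S // ∀ x, t.1 x ∈ U.1} ≃
        {U : {U : Submodule F V // U.map V₁.mkQ = U' ∧ ∀ x, t.1 x ∈ U} //
          Module.finrank F U.1 = dU} :=
      { toFun := fun U => ⟨⟨U.1.1, U.1.2.2, U.2⟩, U.1.2.1⟩
        invFun := fun U => ⟨⟨U.1.1, U.2, U.1.2.1⟩, U.1.2.2⟩
        left_inv := fun _ => rfl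
        right_inv := fun _ => rfl }
    exact Nat.card_congr (e₁.trans ((LiftInto.equivSubmodule t.1 t.2).subtypeEquiv
      fun U => hfinrank U.1 U.2.1))
  let e : (Σ U : S, {t : T // ∀ x, t.1 x ∈ U.1}) ≃ Σ t : T, {U : S // ∀ x, t.1 x ∈ U.1} :=
    { toFun := fun p => ⟨p.2.1, p.1, p.2.2⟩
      invFun := fun p => ⟨p.2.1, p.1, p.2.2⟩
      left_inv := fun _ => rfl
      right_inv := fun _ => rfl }
  have : Fintype S := Fintype.ofFinite S
  have : Fintype T := Fintype.ofFinite T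
  have hcount := Nat.card_congr e
  rw [Nat.card_sigma, Nat.card_sigma, Finset.sum_congr rfl fun U _ => hS U,
    Finset.sum_congr rfl fun t _ => hfib t, Finset.sum_const, Finset.sum_const,
    Finset.card_univ, Finset.card_univ, ← Nat.card_eq_fintype_card (α := S),
    ← Nat.card_eq_fintype_card (α := T), hT, smul_eq_mul, smul_eq_mul] at hcount
  have hq : 0 < Fintype.card F := Fintype.card_pos
  apply Nat.eq_of_mul_eq_mul_right (pow_pos hq (Module.finrank F U' * k))
  refine hcount.trans ?_
  rcases le_or_gt k (Module.finrank F V₁) with hk | hk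
  · rw [mul_right_comm, ← pow_add, ← mul_add, Nat.sub_add_cancel hk]
  · change _ = _ * gaussBinom _ _ k * _
    rw [gaussBinom_eq_zero_of_lt _ hk, mul_zero, mul_zero, zero_mul]
end

section
/- Let U and V be subspaces of F_q^m with U ∩ V = {0}, dim U = d_U and dim V = d_V, and let d_W be a nonnegative integer. If 0 ≤ d_W ≤ min{d_U, d_V}, then the number of d_W-dimensional subspaces W with W ⊆ U + V and W ∩ U = W ∩ V = {0} equals [d_U choose d_W]_q · ∏_{i=0}^{d_W − 1}(q^{d_V} − q^i); if d_W > min{d_U, d_V}, there are no such subspaces W. -/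
open Module Submodule

section LinearIndependentSum

variable {K E ι : Type*} [Field K] [AddCommGroup E] [Module K E]

theorem sum_smul_mem_left_iff_of_disjoint [Fintype ι] {U V : Submodule K E} (h : Disjoint U V)
    (s : ι → U) (t : ι → V) (c : ι → K) :
    ∑ i, c i • ((s i : E) + t i) ∈ U ↔ ∑ i, c i • t i = 0 := by
  have hs : ∑ i, c i • (s i : E) ∈ U := U.sum_mem fun i _ ↦ U.smul_mem _ (s i).2
  have ht : ((∑ i, c i • t i : V) : E) = ∑ i, c i • (t i : E) := by simp
  simp only [smul_add, Finset.sum_add_distrib]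
  rw [U.add_mem_iff_right hs, ← ht]
  refine ⟨fun hU ↦ ?_, fun h0 ↦ by simp [h0]⟩
  exact Subtype.ext (disjoint_def.1 h _ hU (SetLike.coe_mem _))

theorem LinearIndependent.add_of_disjoint [Fintype ι] {U V : Submodule K E} (h : Disjoint U V)
    {s : ι → U} {t : ι → V} (ht : LinearIndependent K t) :
    LinearIndependent K (fun i ↦ (s i : E) + t i) :=
  Fintype.linearIndependent_iff.2 fun c hc ↦ Fintype.linearIndependent_iff.1 ht c <|
    (sum_smul_mem_left_iff_of_disjoint h s t c).1 (hc ▸ U.zero_mem)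

theorem disjoint_span_range_add_iff [Fintype ι] {U V : Submodule K E} (h : Disjoint U V)
    {s : ι → U} {t : ι → V} (hb : LinearIndependent K (fun i ↦ (s i : E) + t i)) :
    Disjoint (span K (Set.range fun i ↦ (s i : E) + t i)) U ↔ LinearIndependent K t := by
  rw [disjoint_def, Fintype.linearIndependent_iff]
  constructor
  · intro hd c hc
    refine Fintype.linearIndependent_iff.1 hb c (hd _ ?_ ?_)
    · exact (mem_span_range_iff_exists_fun K).2 ⟨c, rfl⟩
    · exact (sum_smul_mem_left_iff_of_disjoint h s t c).2 hc
  · intro ht x hx hU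
    obtain ⟨c, rfl⟩ := (mem_span_range_iff_exists_fun K).1 hx
    have := ht c ((sum_smul_mem_left_iff_of_disjoint h s t c).1 hU)
    simp [this]

/-- Linearly independent families spanning a subspace of `U ⊔ V` that meets `U` and `V` trivially
correspond to pairs of linearly independent families in `U` and in `V`. -/
theorem card_linearIndependent_span_disjoint [Fintype ι] {U V : Submodule K E}
    (h : Disjoint U V) :
    Nat.card {b : ι → E // LinearIndependent K b ∧ span K (Set.range b) ≤ U ⊔ V ∧
      span K (Set.range b) ⊓ U = ⊥ ∧ span K (Set.range b) ⊓ V = ⊥} =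
    Nat.card {s : ι → U // LinearIndependent K s} *
      Nat.card {t : ι → V // LinearIndependent K t} := by
  rw [← Nat.card_prod]
  have hle (s : ι → U) (t : ι → V) : span K (Set.range fun i ↦ (s i : E) + t i) ≤ U ⊔ V := by
    rw [span_le]
    rintro _ ⟨i, rfl⟩
    exact add_mem_sup (s i).2 (t i).2
  have hcomm (s : ι → U) (t : ι → V) :
      (fun i ↦ (s i : E) + t i) = fun i ↦ (t i : E) + s i := funext fun i ↦ add_comm _ _
  symm
  refine Nat.card_eq_of_bijective (fun p ↦ ⟨fun i ↦ (p.1.1 i : E) + p.2.1 i,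
    p.2.2.add_of_disjoint h, hle _ _, ?_, ?_⟩) ⟨?_, ?_⟩
  · exact ((disjoint_span_range_add_iff h (p.2.2.add_of_disjoint h)).2 p.2.2).eq_bot
  · rw [hcomm]
    exact ((disjoint_span_range_add_iff h.symm (p.1.2.add_of_disjoint h.symm)).2 p.1.2).eq_bot
  · rintro ⟨⟨s, hs⟩, ⟨t, ht⟩⟩ ⟨⟨s', hs'⟩, ⟨t', ht'⟩⟩ heq
    have hi (i : ι) : (s i : E) + t i = s' i + t' i := congrFun (Subtype.ext_iff.1 heq) i
    have hst (i : ι) : s i = s' i := by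
      have hmem : (s i : E) - s' i ∈ V := by
        rw [show (s i : E) - s' i = t' i - t i by
          rw [sub_eq_sub_iff_add_eq_add, hi, add_comm]]
        exact V.sub_mem (t' i).2 (t i).2
      exact Subtype.ext (sub_eq_zero.1 (disjoint_def.1 h _ (U.sub_mem (s i).2 (s' i).2) hmem))
    have htt (i : ι) : t i = t' i := Subtype.ext (by simpa [hst i] using hi i)
    simp only [Prod.mk.injEq, Subtype.mk.injEq]
    exact ⟨funext hst, funext htt⟩
  · rintro ⟨b, hb, hbUV, hbU, hbV⟩
    have hex (i : ι) : ∃ (x : U) (y : V), (x : E) + y = b i := by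
      obtain ⟨x, hx, y, hy, hxy⟩ := mem_sup.1 (hbUV (subset_span (Set.mem_range_self i)))
      exact ⟨⟨x, hx⟩, ⟨y, hy⟩, hxy⟩
    choose s t hst using hex
    obtain rfl : (fun i ↦ (s i : E) + t i) = b := funext hst
    have ht := (disjoint_span_range_add_iff h hb).1 (disjoint_iff.2 hbU)
    rw [hcomm] at hb hbV
    have hs := (disjoint_span_range_add_iff h.symm hb).1 (disjoint_iff.2 hbV)
    exact ⟨(⟨s, hs⟩, ⟨t, ht⟩), rfl⟩

end LinearIndependentSum

section Counting

variable {K E : Type*} [Field K] [Fintype K] [AddCommGroup E] [Module K E] [Finite E]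

/-- A linearly independent family is the same as a basis of its span. -/
theorem card_submodule_mul_prod (k : ℕ) (P : Submodule K E → Prop) :
    Nat.card {W : Submodule K E // finrank K W = k ∧ P W} *
      ∏ i ∈ Finset.range k, (Fintype.card K ^ k - Fintype.card K ^ i) =
    Nat.card {b : Fin k → E // LinearIndependent K b ∧ P (span K (Set.range b))} := by
  have := Fintype.ofFinite {W : Submodule K E // finrank K W = k ∧ P W}
  have hspan (W : {W : Submodule K E // finrank K W = k ∧ P W})
      (s : {s : Fin k → W.1 // LinearIndependent K s}) :
      span K (Set.range fun i ↦ (s.1 i : E)) = W.1 := by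
    have hli : LinearIndependent K fun i ↦ (s.1 i : E) := s.2.map' W.1.subtype W.1.ker_subtype
    refine eq_of_le_of_finrank_eq ?_ ?_
    · rw [span_le]
      rintro _ ⟨i, rfl⟩
      exact (s.1 i).2
    · rw [finrank_span_eq_card hli, Fintype.card_fin, W.2.1]
  have hcard (W : {W : Submodule K E // finrank K W = k ∧ P W}) :
      Nat.card {s : Fin k → W.1 // LinearIndependent K s} =
        ∏ i ∈ Finset.range k, (Fintype.card K ^ k - Fintype.card K ^ i) := by
    rw [card_linearIndependent W.2.1.ge, W.2.1,
      Finset.prod_range fun i ↦ Fintype.card K ^ k - Fintype.card K ^ i]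
  trans Nat.card (Σ W : {W : Submodule K E // finrank K W = k ∧ P W},
    {s : Fin k → W.1 // LinearIndependent K s})
  · rw [Nat.card_sigma, Finset.sum_congr rfl fun W _ ↦ hcard W, Finset.sum_const,
      Finset.card_univ, Nat.card_eq_fintype_card, smul_eq_mul]
  · refine Nat.card_eq_of_bijective (fun p ↦ ⟨fun i ↦ (p.2.1 i : E),
      p.2.2.map' p.1.1.subtype p.1.1.ker_subtype, ?_⟩) ⟨?_, ?_⟩
    · rw [hspan]
      exact p.1.2.2
    · rintro ⟨W, s⟩ ⟨W', s'⟩ heq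
      have hf : (fun i ↦ (s.1 i : E)) = fun i ↦ (s'.1 i : E) := Subtype.ext_iff.1 heq
      obtain rfl : W = W' := Subtype.ext (by rw [← hspan W s, ← hspan W' s', hf])
      obtain rfl : s = s' := Subtype.ext (funext fun i ↦ Subtype.ext (congrFun hf i))
      rfl
    · rintro ⟨b, hb, hP⟩
      exact ⟨⟨⟨span K (Set.range b), by simpa using finrank_span_eq_card hb, hP⟩,
        ⟨_, linearIndependent_span hb⟩⟩, rfl⟩

theorem prod_pow_sub_pow_pos (k : ℕ) :
    0 < ∏ i ∈ Finset.range k, (Fintype.card K ^ k - Fintype.card K ^ i) :=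
  Finset.prod_pos fun _ hi ↦ Nat.sub_pos_of_lt <|
    Nat.pow_lt_pow_right Fintype.one_lt_card (Finset.mem_range.1 hi)

theorem gaussBinom_mul_prod {k : ℕ} (hk : k ≤ finrank K E) :
    gaussBinom (Fintype.card K) (finrank K E) k *
      ∏ i ∈ Finset.range k, (Fintype.card K ^ k - Fintype.card K ^ i) =
    ∏ i ∈ Finset.range k, (Fintype.card K ^ finrank K E - Fintype.card K ^ i) := by
  refine Nat.div_mul_cancel (Dvd.intro_left
    (Nat.card {W : Submodule K E // finrank K W = k ∧ True}) ?_)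
  rw [card_submodule_mul_prod k fun _ ↦ True,
    Finset.prod_range fun i ↦ Fintype.card K ^ finrank K E - Fintype.card K ^ i]
  simpa only [and_true] using card_linearIndependent hk

end Counting

theorem card_linearIndependent_eq_zero {K E : Type*} [Field K] [AddCommGroup E] [Module K E]
    [FiniteDimensional K E] {k : ℕ} (hk : finrank K E < k) :
    Nat.card {s : Fin k → E // LinearIndependent K s} = 0 := by
  have : IsEmpty {s : Fin k → E // LinearIndependent K s} :=
    ⟨fun s ↦ hk.not_ge (by simpa using s.2.fintype_card_le_finrank)⟩
  exact Nat.card_of_isEmpty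

/-- counting `d_W`-dimensional subspaces `W ⊆ U ⊕ V` meeting both `U` and
`V` trivially, where `U, V ⊆ F_q^m` have trivial intersection. -/
theorem count_complementary_subspaces
    (q m : ℕ) (F : Type*) [Field F] [Fintype F] (hq : Fintype.card F = q)
    (U V : Submodule F (Fin m → F)) (hUV : U ⊓ V = ⊥)
    (dU dV dW : ℕ)
    (hdU : Module.finrank F U = dU) (hdV : Module.finrank F V = dV) :
    (dW ≤ min dU dV →
      Nat.card {W : Submodule F (Fin m → F) //
          Module.finrank F W = dW ∧ W ≤ U ⊔ V ∧ W ⊓ U = ⊥ ∧ W ⊓ V = ⊥} =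
        gaussBinom q dU dW * ∏ i ∈ Finset.range dW, (q ^ dV - q ^ i)) ∧
    (min dU dV < dW →
      Nat.card {W : Submodule F (Fin m → F) //
          Module.finrank F W = dW ∧ W ≤ U ⊔ V ∧ W ⊓ U = ⊥ ∧ W ⊓ V = ⊥} = 0) := by
  subst hq hdU hdV
  have key := (card_submodule_mul_prod dW fun W ↦ W ≤ U ⊔ V ∧ W ⊓ U = ⊥ ∧ W ⊓ V = ⊥).trans
    (card_linearIndependent_span_disjoint (disjoint_iff.2 hUV))
  have hpos := prod_pow_sub_pow_pos (K := F) dW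
  refine ⟨fun hle ↦ Nat.eq_of_mul_eq_mul_right hpos ?_, fun hlt ↦ ?_⟩
  · rw [key, card_linearIndependent (hle.trans (min_le_left _ _)),
      card_linearIndependent (hle.trans (min_le_right _ _)), mul_right_comm,
      gaussBinom_mul_prod (hle.trans (min_le_left _ _)), Finset.prod_range, Finset.prod_range]
  · refine (Nat.mul_eq_zero.1 (key.trans (Nat.mul_eq_zero.2 ?_))).resolve_right hpos.ne'
    exact (min_lt_iff.1 hlt).imp card_linearIndependent_eq_zero card_linearIndependent_eq_zero
end

section
/- Let n, m be positive integers and let R be a probability distribution on {0, 1, ..., min{n,m}}. Let X be a random matrix in F_q^{n×m} with arbitrary distribution, and let B be a random matrix in F_q^{n×m}, independent of X, distributed Uniform Given Rank with rank distribution R. For each s ∈ {0, ..., min{n,m}} fix a matrix X_s ∈ F_q^{n×m} with rank(X_s) = s. Then for every r ∈ {0, ..., min{n,m}}, Prob(rank(X + B) = r) = Σ_{r_X = 0}^{min{n,m}} Σ_{r_B = 0}^{min{n,m}} Prob(rank(X) = r_X) · R(r_B) · |{B₀ ∈ F_q^{n×m} : rank(B₀) = r_B and rank(X_{r_X} + B₀)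 = r}| / |{B₀ ∈ F_q^{n×m} : rank(B₀) = r_B}|. In particular, the distribution of rank(X + B) depends only on the distribution of rank(X), not on the distribution of X itself. -/
/-- Two linear maps between finite-dimensional spaces whose ranges have the same dimension are
equivalent. -/
theorem LinearMap.exists_equiv_comp_eq_of_finrank_range_eq {K V W : Type*} [Field K]
    [AddCommGroup V] [Module K V] [AddCommGroup W] [Module K W]
    [FiniteDimensional K V] [FiniteDimensional K W] (f g : V →ₗ[K] W)
    (h : Module.finrank K (LinearMap.range f) = Module.finrank K (LinearMap.range g)) :
    ∃ (φ : V ≃ₗ[K] V) (ψ : W ≃ₗ[K] W), ∀ x, ψ (f x) = g (φ x) := by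
  have hker : Module.finrank K (LinearMap.ker f) = Module.finrank K (LinearMap.ker g) := by
    have hf := f.finrank_range_add_finrank_ker
    have hg := g.finrank_range_add_finrank_ker
    omega
  obtain ⟨φ, hφ⟩ := Submodule.exists_linearEquiv_restrict_eq (LinearEquiv.ofFinrankEq _ _ hker)
  have hφ' : Submodule.map (φ : V →ₗ[K] V) (LinearMap.ker f) = LinearMap.ker g := by
    apply Submodule.eq_of_le_of_finrank_eq
    · rintro _ ⟨x, hx, rfl⟩
      have := hφ ⟨x, hx⟩
      simp only [LinearEquiv.coe_coe] at this ⊢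
      rw [← this]
      exact Subtype.prop _
    · rw [← hker]
      exact LinearEquiv.finrank_map_eq φ _
  have hfg : LinearMap.ker f = LinearMap.ker (g ∘ₗ (φ : V →ₗ[K] V)) := by
    rw [LinearMap.ker_comp, ← hφ', Submodule.comap_map_eq_of_injective φ.injective]
  obtain ⟨ψ, hψ⟩ := Submodule.exists_linearEquiv_restrict_eq
    (f.quotKerEquivRange.symm ≪≫ₗ Submodule.quotEquivOfEq _ _ hfg ≪≫ₗ
      (g ∘ₗ (φ : V →ₗ[K] V)).quotKerEquivRange)
  refine ⟨φ, ψ, fun x => ?_⟩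
  have hx := hψ ⟨f x, LinearMap.mem_range_self f x⟩
  simp only [LinearEquiv.trans_apply, LinearMap.quotKerEquivRange_symm_apply_image,
    Submodule.mkQ_apply, Submodule.quotEquivOfEq_mk, LinearMap.quotKerEquivRange_apply_mk] at hx
  exact hx.symm

/-- Two matrices of the same rank over a field are equivalent. -/
theorem Matrix.exists_isUnit_det_mul_mul_eq_of_rank_eq {K m n : Type*} [Field K]
    [Fintype m] [DecidableEq m] [Fintype n] [DecidableEq n] (A B : Matrix m n K)
    (h : A.rank = B.rank) :
    ∃ (P : Matrix m m K) (Q : Matrix n n K), IsUnit P.det ∧ IsUnit Q.det ∧ P * A * Q = B := by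
  obtain ⟨φ, ψ, hψ⟩ :=
    LinearMap.exists_equiv_comp_eq_of_finrank_range_eq (toLin' A) (toLin' B) h
  refine ⟨LinearMap.toMatrix' ψ.toLinearMap, LinearMap.toMatrix' φ.symm.toLinearMap,
    ?_, ?_, ?_⟩
  · rw [LinearMap.det_toMatrix']
    exact ψ.isUnit_det'
  · rw [LinearMap.det_toMatrix']
    exact φ.symm.isUnit_det'
  · apply toLin'.injective
    refine LinearMap.ext fun x => ?_
    simp only [toLin'_mul, LinearMap.comp_apply, toLin'_toMatrix', LinearEquiv.coe_coe, hψ,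
      LinearEquiv.apply_symm_apply]

/-- The number of matrices `N` of rank `s` for which `A + N` has rank `r` depends only on the
rank of `A`. -/
theorem Matrix.card_rank_eq_and_rank_add_eq_congr {K m n : Type*} [Field K]
    [Fintype m] [Fintype n] {A B : Matrix m n K} (h : A.rank = B.rank) (s r : ℕ) :
    Nat.card {N : Matrix m n K // N.rank = s ∧ (A + N).rank = r} =
      Nat.card {N : Matrix m n K // N.rank = s ∧ (B + N).rank = r} := by
  classical
  obtain ⟨P, Q, hP, hQ, rfl⟩ := exists_isUnit_det_mul_mul_eq_of_rank_eq A B h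
  refine Nat.card_congr (Equiv.subtypeEquiv
    { toFun := fun N => P * N * Q
      invFun := fun N => P⁻¹ * N * Q⁻¹
      left_inv := fun N => by
        beta_reduce
        rw [Matrix.mul_assoc P N Q, nonsing_inv_mul_cancel_left P _ hP,
          mul_nonsing_inv_cancel_right Q _ hQ]
      right_inv := fun N => by
        beta_reduce
        rw [Matrix.mul_assoc P⁻¹ N Q⁻¹, mul_nonsing_inv_cancel_left P _ hP,
          nonsing_inv_mul_cancel_right Q _ hQ] } fun N => ?_)
  simp only [Equiv.coe_fn_mk]
  rw [← Matrix.add_mul, ← Matrix.mul_add]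
  simp only [rank_mul_eq_left_of_isUnit_det _ _ hQ, rank_mul_eq_right_of_isUnit_det _ _ hP]

/-- the rank distribution of `X + B`, where `B` is Uniform Given Rank with
rank distribution `R` and independent of `X`, depends only on the rank distribution of
`X`; it is given by the displayed double sum. -/
theorem rank_distribution_of_sum
    (q n m : ℕ) (hn : 0 < n) (hm : 0 < m)
    (F : Type*) [Field F] [Fintype F] (hq : Fintype.card F = q)
    -- `R` is a probability distribution on `{0, 1, ..., min n m}`
    (R : ℕ → ℝ) (hR0 : ∀ i, 0 ≤ R i)
    (hR1 : ∑ i ∈ Finset.range (min n m + 1), R i = 1)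
    (hRsupp : ∀ i, min n m < i → R i = 0)
    -- `p` is the (arbitrary) distribution of `X`
    (p : Matrix (Fin n) (Fin m) F → ℝ) (hp0 : ∀ M, 0 ≤ p M)
    (hp1 : ∑ M : Matrix (Fin n) (Fin m) F, p M = 1)
    -- `pB` is the UGR distribution with rank distribution `R`: the distribution of `B`
    (pB : Matrix (Fin n) (Fin m) F → ℝ)
    (hpB : ∀ M : Matrix (Fin n) (Fin m) F,
      pB M = R M.rank /
        (Nat.card {M' : Matrix (Fin n) (Fin m) F // M'.rank = M.rank} : ℝ))
    -- fixed representative matrices of each rank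
    (Xs : ℕ → Matrix (Fin n) (Fin m) F) (hXs : ∀ s ≤ min n m, (Xs s).rank = s) :
    ∀ r ≤ min n m,
      -- `Prob(rank (X + B) = r)` for `X, B` independent with distributions `p, pB`
      (∑ X₀ : Matrix (Fin n) (Fin m) F, ∑ B₀ : Matrix (Fin n) (Fin m) F,
        (if (X₀ + B₀).rank = r then p X₀ * pB B₀ else 0)) =
      ∑ rX ∈ Finset.range (min n m + 1), ∑ rB ∈ Finset.range (min n m + 1),
        (∑ X₀ : Matrix (Fin n) (Fin m) F, if X₀.rank = rX then p X₀ else 0) * R rB *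
          (Nat.card {B₀ : Matrix (Fin n) (Fin m) F //
              B₀.rank = rB ∧ (Xs rX + B₀).rank = r} : ℝ) /
          (Nat.card {B₀ : Matrix (Fin n) (Fin m) F // B₀.rank = rB} : ℝ) := by
  intro r _
  have rank_mem (M : Matrix (Fin n) (Fin m) F) : M.rank ∈ Finset.range (min n m + 1) := by
    have h₁ := M.rank_le_height
    have h₂ := M.rank_le_width
    rw [Finset.mem_range]
    omega
  have inner_sum (X₀ : Matrix (Fin n) (Fin m) F) :
      (∑ B₀ : Matrix (Fin n) (Fin m) F,
        if (X₀ + B₀).rank = r then p X₀ * pB B₀ else 0) =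
      ∑ rB ∈ Finset.range (min n m + 1), p X₀ * R rB *
        (Nat.card {B₀ : Matrix (Fin n) (Fin m) F //
          B₀.rank = rB ∧ (Xs X₀.rank + B₀).rank = r} : ℝ) /
        (Nat.card {B₀ : Matrix (Fin n) (Fin m) F // B₀.rank = rB} : ℝ) := by
    rw [← Finset.sum_fiberwise_of_maps_to fun B₀ _ => rank_mem B₀]
    refine Finset.sum_congr rfl fun rB _ => ?_
    have hX : X₀.rank = (Xs X₀.rank).rank :=
      (hXs _ (Nat.lt_succ_iff.mp (Finset.mem_range.mp (rank_mem X₀)))).symm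
    rw [← Matrix.card_rank_eq_and_rank_add_eq_congr hX, ← Finset.sum_filter,
      Finset.filter_filter,
      Finset.sum_congr rfl fun B₀ hB₀ => by
        rw [hpB, (Finset.mem_filter.mp hB₀).2.1],
      Finset.sum_const, nsmul_eq_mul, Nat.card_eq_fintype_card (α := {_B // _ ∧ _}),
      Fintype.card_subtype]
    ring
  simp_rw [inner_sum]
  rw [← Finset.sum_fiberwise_of_maps_to fun X₀ _ => rank_mem X₀]
  refine Finset.sum_congr rfl fun rX _ => ?_
  rw [Finset.sum_comm]
  refine Finset.sum_congr rfl fun rB _ => ?_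
  rw [← Finset.sum_filter, Finset.sum_mul, Finset.sum_mul, Finset.sum_div]
  refine Finset.sum_congr rfl fun X₀ hX₀ => ?_
  rw [(Finset.mem_filter.mp hX₀).2]
end

section
/- Let n, m be positive integers and let p and p' be probability distributions on F_q^{n×m} that are both Uniform Given Rank. If X and B are independent random matrices with X distributed according to p and B distributed according to p', then the distribution of X + B is Uniform Given Rank; equivalently, for all matrices D₁, D₂ ∈ F_q^{n×m} with rank(D₁) = rank(D₂), Σ_{M ∈ F_q^{n×m}} p(M) · p'(D₁ − M) = Σ_{M ∈ F_q^{n×m}} p(M) · p'(D₂ − M). -/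
/-- Two linear maps of equal rank between finite-dimensional spaces are equivalent up to
automorphisms of the source and of the target. -/
theorem LinearMap.exists_linearEquiv_comp_eq_of_finrank_range_eq
    {K V W : Type*} [Field K] [AddCommGroup V] [Module K V] [FiniteDimensional K V]
    [AddCommGroup W] [Module K W] [FiniteDimensional K W] (f g : V →ₗ[K] W)
    (h : Module.finrank K (LinearMap.range f) = Module.finrank K (LinearMap.range g)) :
    ∃ (a : V ≃ₗ[K] V) (b : W ≃ₗ[K] W), b.toLinearMap ∘ₗ f = g ∘ₗ a.toLinearMap := by
  obtain ⟨C, hC⟩ := (LinearMap.ker f).exists_isCompl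
  obtain ⟨C', hC'⟩ := (LinearMap.ker g).exists_isCompl
  obtain ⟨S, hS⟩ := (LinearMap.range f).exists_isCompl
  obtain ⟨S', hS'⟩ := (LinearMap.range g).exists_isCompl
  have hker : Module.finrank K (LinearMap.ker f) = Module.finrank K (LinearMap.ker g) := by
    have := f.finrank_range_add_finrank_ker
    have := g.finrank_range_add_finrank_ker
    omega
  have hcompl : Module.finrank K S = Module.finrank K S' := by
    have := Submodule.finrank_add_eq_of_isCompl hS
    have := Submodule.finrank_add_eq_of_isCompl hS'
    omega
  let ρ := LinearEquiv.ofFinrankEq _ _ h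
  let κ := LinearEquiv.ofFinrankEq _ _ hker
  let σ := LinearEquiv.ofFinrankEq _ _ hcompl
  let γ := f.kerComplementEquivRange hC.symm ≪≫ₗ ρ ≪≫ₗ
    (g.kerComplementEquivRange hC'.symm).symm
  let u := Submodule.prodEquivOfIsCompl _ _ hC
  let w := Submodule.prodEquivOfIsCompl _ _ hS
  refine ⟨u.symm ≪≫ₗ κ.prodCongr γ ≪≫ₗ Submodule.prodEquivOfIsCompl _ _ hC',
    w.symm ≪≫ₗ ρ.prodCongr σ ≪≫ₗ Submodule.prodEquivOfIsCompl _ _ hS', ?_⟩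
  ext x
  obtain ⟨⟨k, c⟩, rfl⟩ := u.surjective x
  have hf : f (u (k, c)) = f.kerComplementEquivRange hC.symm c := by
    have hu : u (k, c) = (k : V) + c := rfl
    rw [hu, map_add, LinearMap.mem_ker.mp k.2, zero_add]
    rfl
  have hg : g (γ c) = ρ (f.kerComplementEquivRange hC.symm c) :=
    congrArg Subtype.val ((g.kerComplementEquivRange hC'.symm).apply_symm_apply _)
  have hw : w.symm (f (u (k, c))) = (f.kerComplementEquivRange hC.symm c, 0) := by
    rw [hf]
    exact Submodule.prodEquivOfIsCompl_symm_apply_left _ _ hS _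
  simp [hw, hg]

/-- Matrices of equal rank over a field are equivalent. -/
theorem Matrix.exists_isUnit_mul_mul_eq_of_rank_eq {K ι κ : Type*} [Field K]
    [Fintype ι] [DecidableEq ι] [Fintype κ] [DecidableEq κ]
    (A B : Matrix ι κ K) (h : A.rank = B.rank) :
    ∃ (P : Matrix ι ι K) (Q : Matrix κ κ K), IsUnit P ∧ IsUnit Q ∧ P * A * Q = B := by
  obtain ⟨a, b, hab⟩ := LinearMap.exists_linearEquiv_comp_eq_of_finrank_range_eq
    (Matrix.toLin' A) (Matrix.toLin' B) h
  refine ⟨LinearMap.toMatrix' b.toLinearMap, LinearMap.toMatrix' a.symm.toLinearMap,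
    LinearMap.isUnit_toMatrix'_iff.mpr ((Module.End.isUnit_iff _).mpr b.bijective),
    LinearMap.isUnit_toMatrix'_iff.mpr ((Module.End.isUnit_iff _).mpr a.symm.bijective), ?_⟩
  apply Matrix.toLin'.injective
  rw [Matrix.toLin'_mul, Matrix.toLin'_mul, Matrix.toLin'_toMatrix', Matrix.toLin'_toMatrix', hab]
  ext
  simp

/-- the sum of two independent Uniform Given Rank random matrices is
Uniform Given Rank. -/
theorem sum_of_UGR_is_UGR
    (q n m : ℕ) (hn : 0 < n) (hm : 0 < m)
    (F : Type*) [Field F] [Fintype F] (hq : Fintype.card F = q)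
    (p p' : Matrix (Fin n) (Fin m) F → ℝ)
    (hp0 : ∀ M, 0 ≤ p M) (hp1 : ∑ M : Matrix (Fin n) (Fin m) F, p M = 1)
    (hp'0 : ∀ M, 0 ≤ p' M) (hp'1 : ∑ M : Matrix (Fin n) (Fin m) F, p' M = 1)
    -- both distributions are Uniform Given Rank
    (hpUGR : ∀ M M' : Matrix (Fin n) (Fin m) F, M.rank = M'.rank → p M = p M')
    (hp'UGR : ∀ M M' : Matrix (Fin n) (Fin m) F, M.rank = M'.rank → p' M = p' M') :
    ∀ D₁ D₂ : Matrix (Fin n) (Fin m) F, D₁.rank = D₂.rank →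
      (∑ M : Matrix (Fin n) (Fin m) F, p M * p' (D₁ - M)) =
        ∑ M : Matrix (Fin n) (Fin m) F, p M * p' (D₂ - M) := by
  intro D₁ D₂ hD
  obtain ⟨P, Q, hP, hQ, rfl⟩ := Matrix.exists_isUnit_mul_mul_eq_of_rank_eq D₁ D₂ hD
  have hrank (M : Matrix (Fin n) (Fin m) F) : (P * M * Q).rank = M.rank := by
    rw [Matrix.rank_mul_eq_left_of_isUnit_det Q _ ((Matrix.isUnit_iff_isUnit_det Q).mp hQ),
      Matrix.rank_mul_eq_right_of_isUnit_det P _ ((Matrix.isUnit_iff_isUnit_det P).mp hP)]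
  have hinj : Function.Injective fun M : Matrix (Fin n) (Fin m) F ↦ P * M * Q := by
    let _ := hP.invertible
    let _ := hQ.invertible
    exact (Matrix.mul_left_injective_of_invertible Q).comp
      (Matrix.mul_right_injective_of_invertible P)
  refine Fintype.sum_bijective _ (Finite.injective_iff_bijective.mp hinj) _ _ fun M ↦ ?_
  rw [hpUGR _ _ (hrank M), ← Matrix.sub_mul, ← Matrix.mul_sub, hp'UGR _ _ (hrank (D₁ - M))]
end

section
/- Let n, m be positive integers, and let M, M' ∈ F_q^{n×m} be fixed matrices with rank(M) = rank(M'). Let B be a random matrix in F_q^{n×m} distributed Uniform Given Rank, and let A be a random matrix distributed uniformly on GL(n,q), independent of B. Then the Shannon entropy of the distribution of A(M + B) equals the Shannon entropy of the distribution of A(M' + B). -/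
/-- The Shannon entropy of a probability distribution `p` on a finite type `S`:
`H(p) = -∑_{s ∈ S} p(s) log p(s)` (with the convention `0 · log 0 = 0`, which holds
automatically since `Real.log 0 = 0`). -/
noncomputable def shannonEntropy {S : Type*} [Fintype S] (p : S → ℝ) : ℝ :=
  -∑ s : S, p s * Real.log (p s)

/-- The distribution of `A(M + B)` where `A` is uniform on `GL(n,q)` and `B` has
distribution `pB`, independent of `A`: the matrix `M` is fixed. -/
noncomputable def outputDist {F : Type*} [Field F] [Fintype F] [DecidableEq F]
    {n m : ℕ} (pB : Matrix (Fin n) (Fin m) F → ℝ) (M : Matrix (Fin n) (Fin m) F) :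
    Matrix (Fin n) (Fin m) F → ℝ := fun Y =>
  ∑ A₀ : GL (Fin n) F, ∑ B₀ : Matrix (Fin n) (Fin m) F,
    (if (A₀ : Matrix (Fin n) (Fin n) F) * (M + B₀) = Y then
      (1 / (Fintype.card (GL (Fin n) F) : ℝ)) * pB B₀ else 0)

/-- Two linear maps between finite-dimensional spaces with ranges of the same dimension differ by
automorphisms of the domain and the codomain. -/
theorem LinearMap.exists_linearEquiv_comp_eq_comp_of_finrank_range_eq {K V W : Type*} [Field K]
    [AddCommGroup V] [Module K V] [FiniteDimensional K V]
    [AddCommGroup W] [Module K W] [FiniteDimensional K W] (f g : V →ₗ[K] W)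
    (h : Module.finrank K (LinearMap.range f) = Module.finrank K (LinearMap.range g)) :
    ∃ (u : W ≃ₗ[K] W) (e : V ≃ₗ[K] V), ∀ x, u (f x) = g (e x) := by
  have hk : Module.finrank K (LinearMap.ker f) = Module.finrank K (LinearMap.ker g) := by
    have := f.finrank_range_add_finrank_ker
    have := g.finrank_range_add_finrank_ker
    omega
  let k := LinearEquiv.ofFinrankEq _ _ hk
  obtain ⟨e, he⟩ := Submodule.exists_linearEquiv_restrict_eq k
  have hker : LinearMap.ker f = LinearMap.ker (g ∘ₗ e.toLinearMap) := by
    refine Submodule.eq_of_le_of_finrank_eq (fun x hx => ?_) ?_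
    · have := (k ⟨x, hx⟩).2
      rw [he ⟨x, hx⟩] at this
      simpa using this
    · have h₁ := g.finrank_range_add_finrank_ker
      have h₂ := (g ∘ₗ e.toLinearMap).finrank_range_add_finrank_ker
      rw [LinearMap.range_comp_of_range_eq_top _ e.range] at h₂
      omega
  let φ := f.quotKerEquivRange.symm ≪≫ₗ Submodule.quotEquivOfEq _ _ hker ≪≫ₗ
    (g ∘ₗ e.toLinearMap).quotKerEquivRange
  obtain ⟨u, hu⟩ := Submodule.exists_linearEquiv_restrict_eq φ
  refine ⟨u, e, fun x => ?_⟩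
  have := hu ⟨f x, LinearMap.mem_range_self f x⟩
  simpa [φ, LinearMap.quotKerEquivRange_symm_apply_image] using this.symm

/-- Matrices of the same rank over a field are equivalent. -/
theorem Matrix.exists_units_mul_mul_eq_of_rank_eq {F : Type*} [Field F] {n m : ℕ}
    {M M' : Matrix (Fin n) (Fin m) F} (h : M.rank = M'.rank) :
    ∃ (U : GL (Fin n) F) (V : GL (Fin m) F), M' = U.1 * M * V.1 := by
  obtain ⟨u, e, hue⟩ := LinearMap.exists_linearEquiv_comp_eq_comp_of_finrank_range_eq
    M.toLin' M'.toLin' h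
  let toGL {k : ℕ} (l : (Fin k → F) ≃ₗ[F] (Fin k → F)) : GL (Fin k) F :=
    { val := LinearMap.toMatrix' l.toLinearMap
      inv := LinearMap.toMatrix' l.symm.toLinearMap
      val_inv := by rw [← LinearMap.toMatrix'_comp]; simp
      inv_val := by rw [← LinearMap.toMatrix'_comp]; simp }
  refine ⟨toGL u, toGL e.symm, Matrix.toLin'.injective <| LinearMap.ext fun x => ?_⟩
  have := hue (e.symm x)
  rw [e.apply_symm_apply] at this
  change _ = Matrix.toLin' (LinearMap.toMatrix' u.toLinearMap * M *
    LinearMap.toMatrix' e.symm.toLinearMap) x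
  rw [Matrix.toLin'_mul, Matrix.toLin'_mul, Matrix.toLin'_toMatrix', Matrix.toLin'_toMatrix']
  exact this.symm

/-- If the law of `B` is uniform given rank, then replacing `M` by the equivalent matrix `U M V`
translates the law of `A (M + B)` by right multiplication by `V`. -/
theorem outputDist_mul_mul {F : Type*} [Field F] [Fintype F] [DecidableEq F] {n m : ℕ}
    {pB : Matrix (Fin n) (Fin m) F → ℝ}
    (hpB : ∀ B B' : Matrix (Fin n) (Fin m) F, B.rank = B'.rank → pB B = pB B')
    (M : Matrix (Fin n) (Fin m) F) (U : GL (Fin n) F) (V : GL (Fin m) F)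
    (Y : Matrix (Fin n) (Fin m) F) :
    outputDist pB (U.1 * M * V.1) (Y * V.1) = outputDist pB M Y := by
  let c : Matrix (Fin n) (Fin m) F ≃ Matrix (Fin n) (Fin m) F :=
    { toFun := fun B => U.1 * B * V.1
      invFun := fun B => U⁻¹.1 * B * V⁻¹.1
      left_inv := fun B => by
        simp only [Matrix.mul_assoc, Units.mul_inv, Matrix.mul_one]
        rw [← Matrix.mul_assoc, Units.inv_mul, Matrix.one_mul]
      right_inv := fun B => by
        simp only [Matrix.mul_assoc, Units.inv_mul, Matrix.mul_one]
        rw [← Matrix.mul_assoc, Units.mul_inv, Matrix.one_mul] }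
  have hc (B) : pB (c B) = pB B := hpB _ _ <| by
    change (U.1 * B * V.1).rank = B.rank
    rw [Matrix.rank_mul_eq_left_of_isUnit_det _ _ ((Matrix.isUnit_iff_isUnit_det _).1 V.isUnit),
      Matrix.rank_mul_eq_right_of_isUnit_det _ _ ((Matrix.isUnit_iff_isUnit_det _).1 U.isUnit)]
  have hV {X : Matrix (Fin n) (Fin m) F} : X * V.1 = Y * V.1 ↔ X = Y := by
    refine ⟨fun h => ?_, fun h => by rw [h]⟩
    simpa [Matrix.mul_assoc, ← Units.val_mul] using congrArg (· * V⁻¹.1) h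
  unfold outputDist
  refine Fintype.sum_equiv (Equiv.mulRight U) _ _ fun A => ?_
  refine (Fintype.sum_equiv c _ _ fun B => ?_).symm
  have : A.1 * (U.1 * M * V.1 + c B) = (A * U).1 * (M + B) * V.1 := by
    change A.1 * (U.1 * M * V.1 + U.1 * B * V.1) = _
    rw [Units.val_mul, ← Matrix.add_mul, ← Matrix.mul_add]
    simp only [Matrix.mul_assoc]
  rw [this, hc]
  exact if_congr hV.symm rfl rfl

/-- if `rank M = rank M'`, `B` is Uniform Given Rank and `A` is uniform on
`GL(n,q)` independent of `B`, then the entropies of the distributions of `A(M + B)` and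
`A(M' + B)` coincide. -/
theorem entropy_eq_of_rank_eq
    (q n m : ℕ) (hn : 0 < n) (hm : 0 < m)
    (F : Type*) [Field F] [Fintype F] [DecidableEq F] (hq : Fintype.card F = q)
    (M M' : Matrix (Fin n) (Fin m) F) (hMM' : M.rank = M'.rank)
    (pB : Matrix (Fin n) (Fin m) F → ℝ)
    (hpB0 : ∀ B₀, 0 ≤ pB B₀) (hpB1 : ∑ B₀ : Matrix (Fin n) (Fin m) F, pB B₀ = 1)
    -- `pB` is Uniform Given Rank
    (hpBUGR : ∀ B₀ B₀' : Matrix (Fin n) (Fin m) F,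
      B₀.rank = B₀'.rank → pB B₀ = pB B₀') :
    shannonEntropy (outputDist pB M) = shannonEntropy (outputDist pB M') := by
  obtain ⟨U, V, rfl⟩ := Matrix.exists_units_mul_mul_eq_of_rank_eq hMM'
  let r : Matrix (Fin n) (Fin m) F ≃ Matrix (Fin n) (Fin m) F :=
    { toFun := fun Y => Y * V.1
      invFun := fun Y => Y * V⁻¹.1
      left_inv := fun Y => by simp only [Matrix.mul_assoc, Units.mul_inv, Matrix.mul_one]
      right_inv := fun Y => by simp only [Matrix.mul_assoc, Units.inv_mul, Matrix.mul_one] }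
  unfold shannonEntropy
  refine congrArg _ (Fintype.sum_equiv r _ _ fun Y => ?_)
  change _ = outputDist pB _ (Y * V.1) * Real.log (outputDist pB _ (Y * V.1))
  rw [outputDist_mul_mul hpBUGR]
end
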